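/- arXiv:2204.08374 — 7 statements merged into one kernel-verified Lean document; each statement's English description precedes it below -/
import Mathlib

section
/- A topological space (X, τ) is scattered if and only if the Löb axiom L is topologically valid on X under Cantor-derivative semantics; explicitly, X is scattered if and only if for every subset A ⊆ X one has d(A) ⊆ d(A ∖ d(A)) (this is the validity, for every valuation, of the contrapositive ◇p → ◇(p ∧ □¬p) of L: □(□p→p)→□p, where ◇ is interpreted as the Cantor derivative and □ as its dual). -/
open scoped Classical

namespace Untangled

noncomputable section

/-- Formulas of the trimodal language `L`. -/
inductive Formula (PV : Type) : Type
  | var : PV → Formula PV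
  | and : Formula PV → Formula PV → Formula PV
  | neg : Formula PV → Formula PV
  | dia : Formula PV → Formula PV
  | next : Formula PV → Formula PV
  | ev : Formula PV → Formula PV
  deriving DecidableEq

namespace Formula

variable {PV : Type}

/-- Implication `φ → ψ := ¬(φ ∧ ¬ψ)`. -/
def impl (φ ψ : Formula PV) : Formula PV := .neg (.and φ (.neg ψ))

/-- Biconditional. -/
def fiff (φ ψ : Formula PV) : Formula PV := .and (impl φ ψ) (impl ψ φ)

/-- `□φ := ¬◇¬φ`. -/
def box (φ : Formula PV) : Formula PV := .neg (.dia (.neg φ))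

/-- `■φ := ¬◆¬φ`. -/
def hence (φ : Formula PV) : Formula PV := .neg (.ev (.neg φ))

/-- The single negation of a formula: strip a leading negation if present,
otherwise negate. -/
def sneg : Formula PV → Formula PV
  | .neg φ => φ
  | φ => .neg φ

end Formula

/-- A formula is a propositional tautology if it evaluates to `true` under
every Boolean valuation of formulas respecting `¬` and `∧`
(modal subformulas are treated as atoms). -/
def IsTautology {PV : Type} (φ : Formula PV) : Prop :=
  ∀ v : Formula PV → Bool,
    (∀ ψ : Formula PV, v ψ.neg = !v ψ) →
    (∀ ψ χ : Formula PV, v (ψ.and χ) = (v ψ && v χ)) →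
    v φ = true

/-- The axiomatic system `DGL`. -/
inductive DGL {PV : Type} : Formula PV → Prop
  | taut {φ : Formula PV} : IsTautology φ → DGL φ
  | axK (φ ψ : Formula PV) : DGL (((φ.impl ψ).box).impl ((φ.box).impl ψ.box))
  | axL (φ : Formula PV) : DGL ((((φ.box).impl φ).box).impl φ.box)
  | axNextNeg (φ : Formula PV) : DGL ((φ.next.neg).fiff (φ.neg.next))
  | axNextAnd (φ ψ : Formula PV) : DGL (((φ.and ψ).next).fiff ((φ.next).and (ψ.next)))
  | axC (φ : Formula PV) : DGL (((φ.next).and ((φ.box).next)).impl ((φ.next).box))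
  | axKHence (φ ψ : Formula PV) : DGL (((φ.impl ψ).hence).impl ((φ.hence).impl (ψ.hence)))
  | axFix (φ : Formula PV) : DGL ((φ.hence).impl (φ.and ((φ.hence).next)))
  | axInd (φ : Formula PV) : DGL (((φ.impl φ.next).hence).impl (φ.impl φ.hence))
  | mp {φ ψ : Formula PV} : DGL (φ.impl ψ) → DGL φ → DGL ψ
  | necBox {φ : Formula PV} : DGL φ → DGL φ.box
  | necNext {φ : Formula PV} : DGL φ → DGL φ.next
  | necHence {φ : Formula PV} : DGL φ → DGL φ.hence

/-- The Cantor derivative of a set: its set of limit points. -/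
def cantorDeriv {X : Type*} [TopologicalSpace X] (A : Set X) : Set X :=
  {x | ∀ U : Set X, IsOpen U → x ∈ U → ∃ y, y ∈ U ∩ A ∧ y ≠ x}

/-- A topological space is scattered if every subset contained in its own
Cantor derivative is empty. -/
def Scattered (X : Type*) [TopologicalSpace X] : Prop :=
  ∀ S : Set X, S ⊆ cantorDeriv S → S = ∅

/-- Truth sets in a dynamic topological model given by a (continuous) map `f`
and a valuation `ν`. -/
def truthSet {PV : Type} {X : Type*} [TopologicalSpace X] (f : X → X) (ν : PV → Set X) :
    Formula PV → Set X
  | .var p => ν p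
  | .and φ ψ => truthSet f ν φ ∩ truthSet f ν ψ
  | .neg φ => (truthSet f ν φ)ᶜ
  | .dia φ => cantorDeriv (truthSet f ν φ)
  | .next φ => f ⁻¹' truthSet f ν φ
  | .ev φ => ⋃ n : ℕ, (f^[n]) ⁻¹' truthSet f ν φ

/-- The downset topology of a (strict) order: open sets are the downward
closed sets. -/
def downsetTopology {X : Type*} (lt : X → X → Prop) : TopologicalSpace X where
  IsOpen U := ∀ x ∈ U, ∀ y, lt y x → y ∈ U
  isOpen_univ := fun _ _ y _ => Set.mem_univ y
  isOpen_inter := fun s t hs ht x hx y hy => ⟨hs x hx.1 y hy, ht x hx.2 y hy⟩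
  isOpen_sUnion := fun S hS x hx y hy => by
    obtain ⟨t, htS, hxt⟩ := hx
    exact ⟨t, htS, hS t htS x hxt y hy⟩
/-- `Σ ⋐ L`: `Γ` is closed under subformulas and single negations
(finiteness is expressed by `Γ : Finset _`). -/
structure GoodSigma {PV : Type} (Γ : Finset (Formula PV)) : Prop where
  and_cl : ∀ φ ψ : Formula PV, Formula.and φ ψ ∈ Γ → φ ∈ Γ ∧ ψ ∈ Γ
  neg_cl : ∀ φ : Formula PV, Formula.neg φ ∈ Γ → φ ∈ Γ
  dia_cl : ∀ φ : Formula PV, Formula.dia φ ∈ Γ → φ ∈ Γ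
  next_cl : ∀ φ : Formula PV, Formula.next φ ∈ Γ → φ ∈ Γ
  ev_cl : ∀ φ : Formula PV, Formula.ev φ ∈ Γ → φ ∈ Γ
  sneg_cl : ∀ φ ∈ Γ, Formula.sneg φ ∈ Γ

/-- `Φ` is a `Σ`-type over `Γ`. -/
structure IsType {PV : Type} (Γ : Finset (Formula PV)) (Φ : Finset (Formula PV)) : Prop where
  subset : Φ ⊆ Γ
  not_both : ∀ φ : Formula PV, ¬(φ ∈ Φ ∧ φ.neg ∈ Φ)
  dneg : ∀ φ : Formula PV, φ.neg.neg ∈ Φ → φ ∈ Φ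
  and_mem : ∀ φ ψ : Formula PV, φ.and ψ ∈ Φ → φ ∈ Φ ∧ ψ ∈ Φ
  nand_mem : ∀ φ ψ : Formula PV, (φ.and ψ).neg ∈ Φ → φ.neg ∈ Φ ∨ ψ.neg ∈ Φ
  hence_mem : ∀ φ : Formula PV, φ.hence ∈ Φ → φ ∈ Φ
  total : ∀ φ ∈ Γ, φ ∈ Φ ∨ Formula.sneg φ ∈ Φ

/-- A sensible pair of types. -/
structure SensiblePair {PV : Type} (Φ Ψ : Finset (Formula PV)) : Prop where
  next_mem : ∀ φ : Formula PV, φ.next ∈ Φ → φ ∈ Ψ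
  next_neg : ∀ φ : Formula PV, φ.next.neg ∈ Φ → φ.neg ∈ Ψ
  ev_mem : ∀ φ : Formula PV, φ.ev ∈ Φ → φ ∈ Φ ∨ φ.ev ∈ Ψ
  hence_mem : ∀ φ : Formula PV, φ.hence ∈ Φ → φ.hence ∈ Ψ

/-- The reflexive closure `≼` of a strict relation. -/
def Rle {W : Type*} (lt : W → W → Prop) (x y : W) : Prop := lt x y ∨ x = y

/-- `n`-fold composition of a relation. -/
def RelIter {W : Type*} (R : W → W → Prop) : ℕ → W → W → Prop
  | 0 => fun x y => x = y
  | n + 1 => fun x z => ∃ y, R x y ∧ RelIter R n y z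

/-- A `Σ`-quasimodel: a locally finite `Σ`-labelled strict poset together with
an ω-sensible (serial, forward-confluent, sensible) transition relation. -/
structure Quasimodel (PV : Type) (Γ : Finset (Formula PV)) where
  good : GoodSigma Γ
  W : Type
  lt : W → W → Prop
  lt_irrefl : ∀ w, ¬ lt w w
  lt_trans : ∀ u v w, lt u v → lt v w → lt u w
  locFin : ∀ w, Set.Finite {v | lt v w}
  label : W → Finset (Formula PV)
  label_type : ∀ w, IsType Γ (label w)
  label_dia : ∀ w (φ : Formula PV), φ.dia ∈ label w → ∃ v, lt v w ∧ φ ∈ label v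
  label_box : ∀ w (φ : Formula PV), φ.box ∈ label w → ∀ v, lt v w → φ ∈ label v
  R : W → W → Prop
  R_fconf : ∀ w w' v, Rle lt w w' → R w v → ∃ v', R w' v' ∧ Rle lt v v'
  R_sens : ∀ w v, R w v → SensiblePair (label w) (label v)
  R_serial : ∀ w, ∃ v, R w v
  R_omega : ∀ w (φ : Formula PV), φ.ev ∈ label w →
      ∃ n v, RelIter R n w v ∧ φ ∈ label v

variable {PV : Type} {Γ : Finset (Formula PV)}

/-- An infinite path in a quasimodel. -/
def IsPath (Q : Quasimodel PV Γ) (π : ℕ → Q.W) : Prop := ∀ n, Q.R (π n) (π (n + 1))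

/-- A realising path in a quasimodel. -/
def IsRealising (Q : Quasimodel PV Γ) (π : ℕ → Q.W) : Prop :=
  IsPath Q π ∧ ∀ m (φ : Formula PV), φ.ev ∈ Q.label (π m) → ∃ k ≥ m, φ ∈ Q.label (π k)

/-- The set (type) `|Q⃗|` of realising paths of `Q`. -/
def RPath (Q : Quasimodel PV Γ) : Type := {π : ℕ → Q.W // IsRealising Q π}

theorem isRealising_shift (Q : Quasimodel PV Γ) (π : ℕ → Q.W) (h : IsRealising Q π) :
    IsRealising Q (fun n => π (n + 1)) := by
  constructor
  · intro n
    exact h.1 (n + 1)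
  · intro m φ hm
    obtain ⟨k, hk, hφ⟩ := h.2 (m + 1) φ hm
    refine ⟨k - 1, by omega, ?_⟩
    have hk1 : k - 1 + 1 = k := by omega
    simpa [hk1] using hφ

/-- The shift map `σ` on realising paths. -/
def shift (Q : Quasimodel PV Γ) (π : RPath Q) : RPath Q :=
  ⟨fun n => π.1 (n + 1), isRealising_shift Q π.1 π.2⟩

/-- The basic `m`-neighbourhood `N_m(π)` of a realising path. -/
def Nbhd (Q : Quasimodel PV Γ) (π : RPath Q) (m : ℕ) : Set (RPath Q) :=
  {ρ | (∀ i < m, Rle Q.lt (ρ.1 i) (π.1 i)) ∧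
       (∀ k < m, ρ.1 k = π.1 k → ∀ j ≥ k, ρ.1 j = π.1 j)}

/-- The topology `T⃗_≺` on `|Q⃗|`, generated by the `m`-neighbourhoods. -/
def limitTopology (Q : Quasimodel PV Γ) : TopologicalSpace (RPath Q) :=
  TopologicalSpace.generateFrom {B | ∃ π m, B = Nbhd Q π m}

/-- The valuation of the limit model. -/
def limitVal (Q : Quasimodel PV Γ) (p : PV) : Set (RPath Q) :=
  {π | Formula.var p ∈ Q.label (π.1 0)}
/-- A `Σ`-state: a finite rooted `Σ`-labelled strict poset (carrier a finite
set of naturals). -/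
structure SState (PV : Type) (Γ : Finset (Formula PV)) where
  carrier : Finset ℕ
  lt : ℕ → ℕ → Prop
  lt_irrefl : ∀ a, ¬ lt a a
  lt_trans : ∀ a b c, lt a b → lt b c → lt a c
  label : ℕ → Finset (Formula PV)
  label_type : ∀ a ∈ carrier, IsType Γ (label a)
  label_dia : ∀ a ∈ carrier, ∀ φ : Formula PV, φ.dia ∈ label a →
      ∃ b ∈ carrier, lt b a ∧ φ ∈ label b
  label_box : ∀ a ∈ carrier, ∀ φ : Formula PV, φ.box ∈ label a →
      ∀ b ∈ carrier, lt b a → φ ∈ label b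
  root : ℕ
  root_mem : root ∈ carrier
  root_top : ∀ a ∈ carrier, a ≠ root → lt a root

namespace SState

variable {PV : Type} {Γ : Finset (Formula PV)}

/-- The label `ℓ(w)` of the root of a state. -/
def topLabel (w : SState PV Γ) : Finset (Formula PV) := w.label w.root

/-- The canonical substate of `w` rooted at `x ∈ |w|`. -/
def substateAt (w : SState PV Γ) (x : ℕ) (hx : x ∈ w.carrier) : SState PV Γ where
  carrier := w.carrier.filter (fun u => w.lt u x ∨ u = x)
  lt := w.lt
  lt_irrefl := w.lt_irrefl
  lt_trans := w.lt_trans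
  label := w.label
  label_type := fun a ha => w.label_type a (Finset.mem_filter.mp ha).1
  label_dia := fun a ha φ hφ => by
    obtain ⟨ha1, ha2⟩ := Finset.mem_filter.mp ha
    obtain ⟨b, hb, hlt, hφb⟩ := w.label_dia a ha1 φ hφ
    refine ⟨b, Finset.mem_filter.mpr ⟨hb, ?_⟩, hlt, hφb⟩
    rcases ha2 with h | h
    · exact Or.inl (w.lt_trans _ _ _ hlt h)
    · exact Or.inl (h ▸ hlt)
  label_box := fun a ha φ hφ b hb hlt =>
    w.label_box a (Finset.mem_filter.mp ha).1 φ hφ b (Finset.mem_filter.mp hb).1 hlt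
  root := x
  root_mem := Finset.mem_filter.mpr ⟨hx, Or.inr rfl⟩
  root_top := fun a ha hne => by
    rcases (Finset.mem_filter.mp ha).2 with h | h
    · exact h
    · exact absurd h hne

theorem substateAt_card_lt (w : SState PV Γ) (x : ℕ) (hx : x ∈ w.carrier.erase w.root) :
    (w.substateAt x (Finset.mem_of_mem_erase hx)).carrier.card < w.carrier.card := by
  apply Finset.card_lt_card
  rw [substateAt, Finset.filter_ssubset]
  refine ⟨w.root, w.root_mem, ?_⟩
  rintro (h | h)
  · exact w.lt_irrefl _ (w.lt_trans _ _ _ h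
      (w.root_top x (Finset.mem_of_mem_erase hx) (Finset.ne_of_mem_erase hx)))
  · exact (Finset.ne_of_mem_erase hx) h.symm

end SState

/-- The verum formula `¬(p₀ ∧ ¬p₀)`. -/
def fTop (PV : Type) [Inhabited PV] : Formula PV :=
  Formula.neg (Formula.and (Formula.var default) (Formula.neg (Formula.var default)))

/-- The falsum formula `p₀ ∧ ¬p₀`. -/
def fBot (PV : Type) [Inhabited PV] : Formula PV :=
  Formula.and (Formula.var default) (Formula.neg (Formula.var default))

/-- Finite conjunction of a list of formulas. -/
def bigAnd {PV : Type} [Inhabited PV] (l : List (Formula PV)) : Formula PV :=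
  l.foldr Formula.and (fTop PV)

/-- Finite disjunction of a list of formulas (`φ ∨ ψ := ¬(¬φ ∧ ¬ψ)`). -/
def bigOr {PV : Type} [Inhabited PV] (l : List (Formula PV)) : Formula PV :=
  l.foldr (fun φ ψ => Formula.neg (Formula.and (Formula.neg φ) (Formula.neg ψ))) (fBot PV)

/-- The simulation formula `Sim(w) := ⋀ℓ_w(0_w) ∧ ⋀_{v ≺ w} ◇Sim(v)`. -/
def Sim {PV : Type} [Inhabited PV] [DecidableEq PV] {Γ : Finset (Formula PV)}
    (w : SState PV Γ) : Formula PV :=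
  Formula.and (bigAnd (w.label w.root).toList)
    (bigAnd (((w.carrier.erase w.root).attach.toList).map
      (fun x => Formula.dia (Sim (w.substateAt x.1 (Finset.mem_of_mem_erase x.2))))))
termination_by w.carrier.card
decreasing_by
  exact SState.substateAt_card_lt w x.1 x.2
/-- `Simulates w v` (`w ◁ v`): there is a labelled simulation `χ ⊆ |w| × |v|`
with `0_w χ 0_v` (label-preserving and strictly forward-confluent). -/
def Simulates {PV : Type} {Γ : Finset (Formula PV)} (w v : SState PV Γ) : Prop :=
  ∃ χ : ℕ → ℕ → Prop,
    (∀ a b, χ a b → a ∈ w.carrier ∧ b ∈ v.carrier) ∧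
    (∀ a b, χ a b → w.label a = v.label b) ∧
    (∀ a' a b, χ a b → w.lt a' a → a' ∈ w.carrier →
      ∃ b' ∈ v.carrier, v.lt b' b ∧ χ a' b') ∧
    χ w.root v.root

/-- `Substate v w` (`v ≺ w`): `v` is the generated substructure of `w` whose
domain is `{u : u ≼_w 0_v}`, for some non-root `0_v ∈ |w|`. -/
def Substate {PV : Type} {Γ : Finset (Formula PV)} (v w : SState PV Γ) : Prop :=
  v.root ∈ w.carrier ∧ v.root ≠ w.root ∧
  v.carrier = w.carrier.filter (fun u => w.lt u v.root ∨ u = v.root) ∧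
  (∀ a ∈ v.carrier, ∀ b ∈ v.carrier, (v.lt a b ↔ w.lt a b)) ∧
  (∀ a ∈ v.carrier, v.label a = w.label a)

/-- `hgt(w)`: the maximal length of a `≺`-chain in `|w|`. -/
def hgt {PV : Type} {Γ : Finset (Formula PV)} (w : SState PV Γ) : ℕ :=
  sSup {n | ∃ c : ℕ → ℕ, (∀ i < n, c i ∈ w.carrier) ∧
    ∀ i j, i < j → j < n → w.lt (c i) (c j)}

/-- `y` is a daughter of `x` in `w`: an immediate `≺`-predecessor. -/
def IsDaughter {PV : Type} {Γ : Finset (Formula PV)} (w : SState PV Γ) (y x : ℕ) : Prop :=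
  y ∈ w.carrier ∧ w.lt y x ∧ ¬ ∃ z ∈ w.carrier, w.lt y z ∧ w.lt z x

/-- `wdt(w)`: the maximal number of pairwise `≺`-incomparable daughters of a
point of `w`. -/
def wdt {PV : Type} {Γ : Finset (Formula PV)} (w : SState PV Γ) : ℕ :=
  sSup {n | ∃ x ∈ w.carrier, ∃ D : Finset ℕ, D.card = n ∧
    (∀ y ∈ D, IsDaughter w y x) ∧
    ∀ y ∈ D, ∀ z ∈ D, y ≠ z → ¬ w.lt y z ∧ ¬ w.lt z y}

/-- The norm `‖w‖ = max(hgt(w), wdt(w))` of a state. -/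
def snorm {PV : Type} {Γ : Finset (Formula PV)} (w : SState PV Γ) : ℕ :=
  max (hgt w) (wdt w)

/-- `MapsTo w v` (`w ↦ v`): there is a sensible (forward-confluent,
label-sensible) relation `R ⊆ |w| × |v|` with `0_w R 0_v`. -/
def MapsTo {PV : Type} {Γ : Finset (Formula PV)} (w v : SState PV Γ) : Prop :=
  ∃ R : ℕ → ℕ → Prop,
    (∀ a b, R a b → a ∈ w.carrier ∧ b ∈ v.carrier) ∧
    (∀ a b, R a b → SensiblePair (w.label a) (v.label b)) ∧
    (∀ a a' b, R a b → Rle w.lt a a' → a' ∈ w.carrier → ∃ b', R a' b' ∧ Rle v.lt b b') ∧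
    R w.root v.root

/-- The set `{◇φ : ◇φ ∈ ℓ_w(u) for some u ∈ |w|}`. -/
def diaSet {PV : Type} [DecidableEq PV] {Γ : Finset (Formula PV)} (w : SState PV Γ) :
    Finset (Formula PV) :=
  w.carrier.biUnion fun u => (w.label u).filter fun φ => ∃ ψ : Formula PV, φ = Formula.dia ψ

/-- `BFuture w v` (`w ⇝ v`): `v` is a bounded future of `w`. -/
def BFuture {PV : Type} [DecidableEq PV] {Γ : Finset (Formula PV)} (w v : SState PV Γ) : Prop :=
  MapsTo w v ∧ snorm v ≤ snorm w + (diaSet w).card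

/-- A state is consistent if the negation of its simulation formula is not
derivable in `DGL`. -/
def Consistent {PV : Type} [Inhabited PV] [DecidableEq PV] {Γ : Finset (Formula PV)}
    (w : SState PV Γ) : Prop :=
  ¬ DGL (Formula.neg (Sim w))

/-- Isomorphism of `Σ`-states (as rooted labelled posets). -/
def SIso {PV : Type} {Γ : Finset (Formula PV)} (w v : SState PV Γ) : Prop :=
  ∃ g : ℕ → ℕ,
    Set.BijOn g ↑w.carrier ↑v.carrier ∧ g w.root = v.root ∧
    (∀ a ∈ w.carrier, ∀ b ∈ w.carrier, (w.lt a b ↔ v.lt (g a) (g b))) ∧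
    (∀ a ∈ w.carrier, w.label a = v.label (g a))

/-- An efficient path of `Σ`-states: consecutive states are bounded futures
and no earlier state simulates a later one. -/
def EfficientPath {PV : Type} [DecidableEq PV] {Γ : Finset (Formula PV)}
    (l : List (SState PV Γ)) : Prop :=
  l.Chain' BFuture ∧
  ∀ (i j : ℕ) (hi : i < l.length) (hj : j < l.length), i < j →
    ¬ Simulates (l.get ⟨i, hi⟩) (l.get ⟨j, hj⟩)

/-- `v ∈ ρ(w)`: `v` is efficiently reachable from `w`, i.e. some efficient
path of consistent states leads from `w` to `v`. -/
def EffReachable {PV : Type} [Inhabited PV] [DecidableEq PV] {Γ : Finset (Formula PV)}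
    (w v : SState PV Γ) : Prop :=
  ∃ l : List (SState PV Γ), EfficientPath l ∧ (∀ u ∈ l, Consistent u) ∧
    l.head? = some w ∧ l.getLast? = some v
/-- a topological space is scattered iff the Löb axiom is
topologically valid under Cantor-derivative semantics, explicitly: iff
`d(A) ⊆ d(A \ d(A))` for every subset `A`. -/
theorem scattered_iff_Lob_valid {X : Type*} [TopologicalSpace X] :
    Scattered X ↔ ∀ A : Set X, cantorDeriv A ⊆ cantorDeriv (A \ cantorDeriv A) := by
  constructor
  · intro h A x hx U hU hxU
    by_contra hcon
    have hA : ∀ y ∈ U, y ∈ A → y ≠ x → y ∈ cantorDeriv A := fun y hyU hyA hyx =>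
      by_contra fun hy => hcon ⟨y, ⟨hyU, hyA, hy⟩, hyx⟩
    have hS : insert x (U ∩ A) ⊆ cantorDeriv (insert x (U ∩ A)) := by
      intro y hy V hV hyV
      have hyUA : y ∈ U ∧ y ∈ cantorDeriv A := by
        by_cases hyx : y = x
        · exact hyx ▸ ⟨hxU, hx⟩
        · obtain ⟨hyU, hyA⟩ := hy.resolve_left hyx
          exact ⟨hyU, hA y hyU hyA hyx⟩
      obtain ⟨z, ⟨⟨hzV, hzU⟩, hzA⟩, hzy⟩ := hyUA.2 (V ∩ U) (hV.inter hU) ⟨hyV, hyUA.1⟩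
      exact ⟨z, ⟨hzV, Or.inr ⟨hzU, hzA⟩⟩, hzy⟩
    exact (Set.insert_nonempty x (U ∩ A)).ne_empty (h _ hS)
  · intro h S hS
    refine Set.eq_empty_of_forall_notMem fun x hx => ?_
    obtain ⟨y, ⟨-, hyS, hy⟩, -⟩ := h S (hS hx) Set.univ isOpen_univ (Set.mem_univ x)
    exact hy (hS hyS)

end

end Untangled
end

section
/- Soundness of DGL: if a formula φ of the trimodal language L is derivable in DGL (⊢ φ), then φ is valid in every scattered dynamical model, i.e. [[φ]] = X in every dynamic topological model (X, τ, f, ν) whose underlying space is scattered. -/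
open scoped Classical

namespace Untangled

noncomputable section

variable {PV : Type} {Γ : Finset (Formula PV)}

section Semantics

variable {X : Type*} [TopologicalSpace X] {f : X → X} {ν : PV → Set X} {φ ψ : Formula PV} {x : X}

theorem mem_truthSet_neg : x ∈ truthSet f ν φ.neg ↔ x ∉ truthSet f ν φ := Iff.rfl

theorem mem_truthSet_and :
    x ∈ truthSet f ν (φ.and ψ) ↔ x ∈ truthSet f ν φ ∧ x ∈ truthSet f ν ψ := Iff.rfl

theorem mem_truthSet_next : x ∈ truthSet f ν φ.next ↔ f x ∈ truthSet f ν φ := Iff.rfl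

theorem mem_truthSet_impl :
    x ∈ truthSet f ν (φ.impl ψ) ↔ (x ∈ truthSet f ν φ → x ∈ truthSet f ν ψ) := by
  simp only [Formula.impl, mem_truthSet_neg, mem_truthSet_and, not_and, not_not]

theorem mem_truthSet_fiff :
    x ∈ truthSet f ν (φ.fiff ψ) ↔ (x ∈ truthSet f ν φ ↔ x ∈ truthSet f ν ψ) := by
  simp only [Formula.fiff, mem_truthSet_and, mem_truthSet_impl, iff_iff_implies_and_implies]

theorem mem_truthSet_box :
    x ∈ truthSet f ν φ.box ↔
      ∃ U : Set X, IsOpen U ∧ x ∈ U ∧ ∀ y ∈ U, y ≠ x → y ∈ truthSet f ν φ := by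
  simp only [Formula.box, truthSet, cantorDeriv, Set.mem_compl_iff, Set.mem_ofPred_eq,
    Set.mem_inter_iff]
  push Not
  grind

theorem mem_truthSet_hence :
    x ∈ truthSet f ν φ.hence ↔ ∀ n : ℕ, f^[n] x ∈ truthSet f ν φ := by
  simp [Formula.hence, truthSet]

theorem IsTautology.mem_truthSet (h : IsTautology φ) (x : X) : x ∈ truthSet f ν φ := by
  simpa using h (fun ψ => decide (x ∈ truthSet f ν ψ))
    (by simp [mem_truthSet_neg]) (by simp [mem_truthSet_and])

/-- Löb's axiom holds in scattered spaces. -/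
theorem Scattered.mem_truthSet_box (hX : Scattered X)
    (h : x ∈ truthSet f ν ((φ.box).impl φ).box) : x ∈ truthSet f ν φ.box := by
  obtain ⟨U, hU, hxU, hbox⟩ := Untangled.mem_truthSet_box.1 h
  by_contra hx
  have hlim : ∀ y ∈ U, y ∉ truthSet f ν φ.box →
      y ∈ cantorDeriv {z | z ∈ U ∧ (z = x ∨ z ∉ truthSet f ν φ)} := by
    intro y hyU hy V hV hyV
    by_contra! hno
    refine hy (Untangled.mem_truthSet_box.2 ⟨V ∩ U, hV.inter hU, ⟨hyV, hyU⟩, fun z hz hzy => ?_⟩)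
    by_contra hzφ
    exact hzy (hno z ⟨hz.1, hz.2, Or.inr hzφ⟩)
  have hS : {z | z ∈ U ∧ (z = x ∨ z ∉ truthSet f ν φ)} = ∅ := by
    refine hX _ fun y ⟨hyU, hy⟩ => hlim y hyU ?_
    by_cases hyx : y = x
    · exact hyx ▸ hx
    · exact fun hyb => hy.resolve_left hyx (mem_truthSet_impl.1 (hbox y hyU hyx) hyb)
  exact Set.eq_empty_iff_forall_notMem.1 hS x ⟨hxU, Or.inl rfl⟩

/-- Axiom `C` holds because `f` is continuous. -/
theorem mem_truthSet_box_next (hf : Continuous f) (h₁ : x ∈ truthSet f ν φ.next)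
    (h₂ : x ∈ truthSet f ν (φ.box).next) : x ∈ truthSet f ν (φ.next).box := by
  obtain ⟨U, hU, hxU, h⟩ := mem_truthSet_box.1 (mem_truthSet_next.1 h₂)
  refine mem_truthSet_box.2 ⟨f ⁻¹' U, hU.preimage hf, hxU, fun y hy _ => ?_⟩
  by_cases hyx : f y = f x
  · exact mem_truthSet_next.2 (hyx ▸ h₁)
  · exact h (f y) hy hyx

theorem DGL.mem_truthSet (h : DGL φ) (hX : Scattered X) (hf : Continuous f) (x : X) :
    x ∈ truthSet f ν φ := by
  induction h generalizing x with
  | taut h => exact h.mem_truthSet x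
  | axK φ ψ =>
    simp only [mem_truthSet_impl, mem_truthSet_box]
    rintro ⟨U, hU, hxU, hUφ⟩ ⟨V, hV, hxV, hVφ⟩
    exact ⟨U ∩ V, hU.inter hV, ⟨hxU, hxV⟩,
      fun y hy hyx => hUφ y hy.1 hyx (hVφ y hy.2 hyx)⟩
  | axL φ => exact mem_truthSet_impl.2 hX.mem_truthSet_box
  | axNextNeg φ => exact mem_truthSet_fiff.2 Iff.rfl
  | axNextAnd φ ψ => exact mem_truthSet_fiff.2 Iff.rfl
  | axC φ => exact mem_truthSet_impl.2 fun h => mem_truthSet_box_next hf h.1 h.2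
  | axKHence φ ψ =>
    simp only [mem_truthSet_impl, mem_truthSet_hence]
    exact fun h hφ n => h n (hφ n)
  | axFix φ =>
    simp only [mem_truthSet_impl, mem_truthSet_and, mem_truthSet_next, mem_truthSet_hence]
    exact fun h => ⟨h 0, fun n => h (n + 1)⟩
  | axInd φ =>
    simp only [mem_truthSet_impl, mem_truthSet_next, mem_truthSet_hence]
    intro h h₀ n
    induction n with
    | zero => exact h₀
    | succ n ih => simpa only [Function.iterate_succ_apply'] using h n ih
  | mp _ _ ih₁ ih₂ => exact mem_truthSet_impl.1 (ih₁ x) (ih₂ x)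
  | necBox _ ih => exact mem_truthSet_box.2 ⟨Set.univ, isOpen_univ, trivial, fun y _ _ => ih y⟩
  | necNext _ ih => exact ih (f x)
  | necHence _ ih => exact mem_truthSet_hence.2 fun n => ih _

end Semantics

/-- soundness of `DGL` for scattered dynamical models. -/
theorem dgl_soundness {PV : Type} (φ : Formula PV) (h : DGL φ) :
    ∀ (X : Type) [TopologicalSpace X], Scattered X →
      ∀ f : X → X, Continuous f → ∀ ν : PV → Set X,
        truthSet f ν φ = Set.univ := by
  intro X _ hX f hf ν
  exact Set.eq_univ_of_forall (h.mem_truthSet hX hf)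

end

end Untangled
end

section
/- Let Q be a Σ-quasimodel. Then (1) the set |Q⃗| of realising paths of Q is closed under the shift map σ, and (2) every finite path (w_1, …, w_n) in Q can be extended to an infinite realising path (w_i)_{i<ω} ∈ |Q⃗|. -/
open scoped Classical

namespace Untangled

noncomputable section

variable {PV : Type} {Γ : Finset (Formula PV)}

/-- The least number of `R`-steps from `w` to a point of `G` (`0` if there is none). -/
def stepDist {W : Type*} (R : W → W → Prop) (G : W → Prop) (w : W) : ℕ :=
  sInf {n | ∃ v, RelIter R n w v ∧ G v}

theorem exists_rel_stepDist_lt {W : Type*} {R : W → W → Prop} {G : W → Prop} {w : W}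
    (hw : ∃ n v, RelIter R n w v ∧ G v) (hG : ¬ G w) :
    ∃ v, R w v ∧ stepDist R G v < stepDist R G w := by
  obtain ⟨u, hu, hGu⟩ := Nat.sInf_mem hw
  change RelIter R (stepDist R G w) w u at hu
  cases hd : stepDist R G w with
  | zero =>
    rw [hd] at hu
    exact absurd ((show w = u from hu) ▸ hGu) hG
  | succ n =>
    rw [hd] at hu
    obtain ⟨v, hwv, hvu⟩ := hu
    exact ⟨v, hwv, Nat.lt_succ_of_le (Nat.sInf_le ⟨u, hvu, hGu⟩)⟩

/-- If each of countably many obligations `P i` persists along a serial relation until its goal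
`G i` is met, and its goal can always be reached, then from any point there is an infinite path
meeting every obligation that occurs on it. -/
theorem exists_fair_path {W ι : Type*} [Countable ι] {R : W → W → Prop} {P G : ι → W → Prop}
    (serial : ∀ w, ∃ v, R w v)
    (persist : ∀ i w v, R w v → P i w → ¬ G i w → P i v)
    (reach : ∀ i w, P i w → ∃ n v, RelIter R n w v ∧ G i v) (w : W) :
    ∃ π : ℕ → W, π 0 = w ∧ (∀ n, R (π n) (π (n + 1))) ∧
      ∀ i m, P i (π m) → ∃ k ≥ m, G i (π k) := by
  obtain ⟨g, hg⟩ := exists_surjective_nat (Option ι)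
  let f : ℕ → Option ι := fun c => g c.unpair.1
  have hf : ∀ i N, ∃ c ≥ N, f c = some i := by
    intro i N
    obtain ⟨a, ha⟩ := hg (some i)
    exact ⟨Nat.pair a N, Nat.right_le_pair a N, by simp [f, ha]⟩
  let pending : ℕ → W → Prop := fun c w => ∃ i, f c = some i ∧ P i w ∧ ¬ G i w
  have step : ∀ c w, ∃ v, R w v ∧ ∀ i, f c = some i → P i w → ¬ G i w →
      stepDist R (G i) v < stepDist R (G i) w := by
    intro c w
    by_cases h : pending c w
    · obtain ⟨i, hi, hP, hG⟩ := h
      obtain ⟨v, hv, hlt⟩ := exists_rel_stepDist_lt (reach i w hP) hG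
      refine ⟨v, hv, fun j hj _ _ => ?_⟩
      obtain rfl : i = j := Option.some.inj (hi.symm.trans hj)
      exact hlt
    · obtain ⟨v, hv⟩ := serial w
      exact ⟨v, hv, fun i hi hP hG => absurd ⟨i, hi, hP, hG⟩ h⟩
  choose next hR hlt using step
  let s : ℕ → ℕ × W := fun n => Nat.rec (0, w)
    (fun _ p => (if pending p.1 p.2 then p.1 else p.1 + 1, next p.1 p.2)) n
  have hs1 : ∀ n, (s (n + 1)).1 = if pending (s n).1 (s n).2 then (s n).1 else (s n).1 + 1 :=
    fun _ => rfl
  have hs2 : ∀ n, (s (n + 1)).2 = next (s n).1 (s n).2 := fun _ => rfl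
  have hpath : ∀ n, R (s n).2 (s (n + 1)).2 := fun n => by
    rw [hs2]
    exact hR _ _
  -- The current target is abandoned only once it is no longer pending, which happens eventually.
  have settle : ∀ n, ∃ k ≥ n, (s k).1 = (s n).1 ∧ ¬ pending (s k).1 (s k).2 := by
    intro n
    by_cases h : pending (s n).1 (s n).2
    · obtain ⟨i, hi, -, -⟩ := h
      induction hd : stepDist R (G i) (s n).2 using Nat.strong_induction_on generalizing n with
      | _ d ih =>
        by_cases h : pending (s n).1 (s n).2
        · have heq : (s (n + 1)).1 = (s n).1 := by rw [hs1, if_pos h]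
          obtain ⟨j, hj, hP, hG⟩ := h
          obtain rfl : i = j := Option.some.inj (hi.symm.trans hj)
          have hdec : stepDist R (G i) (s (n + 1)).2 < d := by
            rw [← hd, hs2]
            exact hlt _ _ i hi hP hG
          obtain ⟨k, hk, hk1, hk2⟩ := ih _ hdec (n + 1) (heq ▸ hi) rfl
          exact ⟨k, by omega, hk1.trans heq, hk2⟩
        · exact ⟨n, le_rfl, rfl, h⟩
    · exact ⟨n, le_rfl, rfl, h⟩
  have visit : ∀ n c, (s n).1 ≤ c → ∃ k ≥ n, (s k).1 = c ∧ ¬ pending c (s k).2 := by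
    intro n c hc
    induction c, hc using Nat.le_induction with
    | base =>
      obtain ⟨k, hk, hk1, hk2⟩ := settle n
      exact ⟨k, hk, hk1, hk1 ▸ hk2⟩
    | succ c _ ih =>
      obtain ⟨k, hk, rfl, hk2⟩ := ih
      have heq : (s (k + 1)).1 = (s k).1 + 1 := by rw [hs1, if_neg hk2]
      obtain ⟨l, hl, hl1, hl2⟩ := settle (k + 1)
      rw [hl1, heq] at hl2
      exact ⟨l, by omega, hl1.trans heq, hl2⟩
  refine ⟨fun n => (s n).2, rfl, hpath, fun i m hP => ?_⟩
  by_contra! hG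
  have hPk : ∀ k ≥ m, P i (s k).2 := by
    intro k hk
    induction k, hk using Nat.le_induction with
    | base => exact hP
    | succ k hk ih => exact persist i _ _ (hpath k) ih (hG k hk)
  obtain ⟨c, hc, hfc⟩ := hf i (s m).1
  obtain ⟨k, hk, -, hnot⟩ := visit m c hc
  exact hnot ⟨i, hfc, hPk k hk, hG k hk⟩

theorem exists_isRealising_of_start (Q : Quasimodel PV Γ) (w : Q.W) :
    ∃ π : ℕ → Q.W, IsRealising Q π ∧ π 0 = w := by
  obtain ⟨π, h0, hpath, hfair⟩ := exists_fair_path (ι := Γ) (R := Q.R)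
    (P := fun φ w => φ.1.ev ∈ Q.label w) (G := fun φ w => φ.1 ∈ Q.label w) Q.R_serial
    (fun φ w v hwv hP hG => ((Q.R_sens w v hwv).ev_mem φ hP).resolve_left hG)
    (fun φ w => Q.R_omega w φ) w
  refine ⟨π, ⟨hpath, fun m φ hφ => ?_⟩, h0⟩
  exact hfair ⟨φ, Q.good.ev_cl φ ((Q.label_type (π m)).subset hφ)⟩ m hφ

theorem isRealising_of_shift {Q : Quasimodel PV Γ} {π : ℕ → Q.W} (h0 : Q.R (π 0) (π 1))
    (h : IsRealising Q (fun n => π (n + 1))) : IsRealising Q π := by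
  have later : ∀ m (φ : Formula PV), φ.ev ∈ Q.label (π (m + 1)) →
      ∃ k ≥ m + 1, φ ∈ Q.label (π k) := by
    intro m φ hφ
    obtain ⟨k, hk, hφk⟩ := h.2 m φ hφ
    exact ⟨k + 1, by omega, hφk⟩
  refine ⟨fun n => ?_, fun m φ hφ => ?_⟩
  · cases n with
    | zero => exact h0
    | succ n => exact h.1 n
  · cases m with
    | zero =>
      rcases (Q.R_sens _ _ h0).ev_mem φ hφ with hφ0 | hφ1
      · exact ⟨0, le_rfl, hφ0⟩
      · obtain ⟨k, _, hφk⟩ := later 0 φ hφ1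
        exact ⟨k, Nat.zero_le k, hφk⟩
    | succ m => exact later m φ hφ

theorem exists_isRealising_extending (Q : Quasimodel PV Γ) (n : ℕ) (w : ℕ → Q.W)
    (hw : ∀ i < n, Q.R (w i) (w (i + 1))) :
    ∃ π : ℕ → Q.W, IsRealising Q π ∧ ∀ i ≤ n, π i = w i := by
  induction n generalizing w with
  | zero =>
    obtain ⟨π, hπ, h0⟩ := exists_isRealising_of_start Q (w 0)
    exact ⟨π, hπ, fun i hi => by rwa [Nat.le_zero.mp hi]⟩
  | succ n ih =>
    obtain ⟨π, hπ, hext⟩ := ih (fun i => w (i + 1)) (fun i hi => hw (i + 1) (by omega))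
    refine ⟨fun i => Nat.casesOn i (w 0) π, isRealising_of_shift ?_ hπ, fun i hi => ?_⟩
    · change Q.R (w 0) (π 0)
      rw [hext 0 (Nat.zero_le n)]
      exact hw 0 (Nat.succ_pos n)
    · cases i with
      | zero => rfl
      | succ i => exact hext i (by omega)

/-- the set of realising paths is closed under the shift, and
every finite path extends to an infinite realising path. -/
theorem rpath_shift_closed_and_extension {PV : Type} {Γ : Finset (Formula PV)}
    (Q : Quasimodel PV Γ) :
    (∀ π : ℕ → Q.W, IsRealising Q π → IsRealising Q (fun n => π (n + 1))) ∧
    (∀ (n : ℕ) (w : ℕ → Q.W), (∀ i < n, Q.R (w i) (w (i + 1))) →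
      ∃ π : ℕ → Q.W, IsRealising Q π ∧ ∀ i ≤ n, π i = w i) := by
  exact ⟨isRealising_shift Q, exists_isRealising_extending Q⟩

end

end Untangled
end

section
/- Let Q be a Σ-quasimodel. The collection B_≺ = {N_m(w⃗) : w⃗ ∈ |Q⃗|, m < ω} of m-neighbourhoods forms a topological basis on the set |Q⃗| of realising paths: the sets N_m(w⃗) cover |Q⃗|, and whenever u⃗ ∈ N_i(w⃗) ∩ N_j(v⃗) there exists a basic set B ∈ B_≺ with u⃗ ∈ B ⊆ N_i(w⃗) ∩ N_j(v⃗). -/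
open scoped Classical

namespace Untangled

noncomputable section

variable {PV : Type} {Γ : Finset (Formula PV)}

theorem Rle.trans (Q : Quasimodel PV Γ) {x y z : Q.W} (hxy : Rle Q.lt x y)
    (hyz : Rle Q.lt y z) : Rle Q.lt x z := by
  rcases hxy with hxy | rfl
  · rcases hyz with hyz | rfl
    · exact Or.inl (Q.lt_trans _ _ _ hxy hyz)
    · exact Or.inl hxy
  · exact hyz

theorem Rle.antisymm (Q : Quasimodel PV Γ) {x y : Q.W} (hxy : Rle Q.lt x y)
    (hyx : Rle Q.lt y x) : x = y := by
  rcases hxy with hxy | rfl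
  · rcases hyx with hyx | rfl
    · exact absurd (Q.lt_trans _ _ _ hxy hyx) (Q.lt_irrefl x)
    · rfl
  · rfl

theorem mem_nbhd_self (Q : Quasimodel PV Γ) (π : RPath Q) (m : ℕ) : π ∈ Nbhd Q π m :=
  ⟨fun _ _ => Or.inr rfl, fun _ _ _ _ _ => rfl⟩

theorem nbhd_subset_nbhd (Q : Quasimodel PV Γ) {ρ π : RPath Q} {n m : ℕ}
    (hρ : ρ ∈ Nbhd Q π n) (hnm : n ≤ m) : Nbhd Q ρ m ⊆ Nbhd Q π n := by
  intro τ hτ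
  refine ⟨fun i hi => (hτ.1 i (hi.trans_le hnm)).trans Q (hρ.1 i hi), fun k hk hτπ j hj => ?_⟩
  have hτρ : τ.1 k = ρ.1 k :=
    (hτ.1 k (hk.trans_le hnm)).antisymm Q (hτπ ▸ hρ.1 k hk)
  exact (hτ.2 k (hk.trans_le hnm) hτρ j hj).trans (hρ.2 k hk (hτρ.symm.trans hτπ) j hj)

/-- the `m`-neighbourhoods form a topological basis on `|Q⃗|`. -/
theorem nbhd_isBasis {PV : Type} {Γ : Finset (Formula PV)} (Q : Quasimodel PV Γ) :
    (∀ ρ : RPath Q, ∃ (π : RPath Q) (m : ℕ), ρ ∈ Nbhd Q π m) ∧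
    (∀ (π₁ π₂ : RPath Q) (i j : ℕ) (ρ : RPath Q),
      ρ ∈ Nbhd Q π₁ i ∩ Nbhd Q π₂ j →
      ∃ (π : RPath Q) (m : ℕ), ρ ∈ Nbhd Q π m ∧
        Nbhd Q π m ⊆ Nbhd Q π₁ i ∩ Nbhd Q π₂ j) := by
  refine ⟨fun ρ => ⟨ρ, 0, mem_nbhd_self Q ρ 0⟩, fun π₁ π₂ i j ρ hρ => ?_⟩
  exact ⟨ρ, max i j, mem_nbhd_self Q ρ _, Set.subset_inter
    (nbhd_subset_nbhd Q hρ.1 (le_max_left i j)) (nbhd_subset_nbhd Q hρ.2 (le_max_right i j))⟩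

end

end Untangled
end

section
/- Let Q be a Σ-quasimodel. The topological space (|Q⃗|, T⃗_≺), consisting of the set of realising paths of Q with the topology generated by the m-neighbourhoods, is scattered: every nonempty A ⊆ |Q⃗| contains a path x⃗ with a neighbourhood O such that O ∩ A = {x⃗} (such an x⃗ can be chosen with x_0 a ≺-minimal first coordinate among members of A, with O = N_1(x⃗)). -/
open scoped Classical

namespace Untangled

noncomputable section

variable {PV : Type} {Γ : Finset (Formula PV)}

theorem Quasimodel.wellFounded_lt (Q : Quasimodel PV Γ) : WellFounded Q.lt := by
  have hord : IsStrictOrder Q.W Q.lt := { irrefl := Q.lt_irrefl, trans := Q.lt_trans }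
  refine ⟨fun w => Acc.intro w fun v hv => ?_⟩
  have hwf : {u | Q.lt u w}.WellFoundedOn Q.lt := (Q.locFin w).wellFoundedOn
  exact hwf.induction (P := Acc Q.lt) hv fun u hu ih =>
    Acc.intro u fun x hx => ih x (Q.lt_trans x u w hx hu) hx

theorem isOpen_nbhd (Q : Quasimodel PV Γ) (π : RPath Q) (m : ℕ) :
    @IsOpen (RPath Q) (limitTopology Q) (Nbhd Q π m) :=
  TopologicalSpace.isOpen_generateFrom_of_mem ⟨π, m, rfl⟩

theorem nbhd_one_inter_eq_singleton (Q : Quasimodel PV Γ) {A : Set (RPath Q)} {π : RPath Q}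
    (hπ : π ∈ A) (hmin : ∀ ρ ∈ A, ¬ Q.lt (ρ.1 0) (π.1 0)) : Nbhd Q π 1 ∩ A = {π} := by
  refine Set.Subset.antisymm ?_ (Set.singleton_subset_iff.2 ⟨mem_nbhd_self Q π 1, hπ⟩)
  rintro ρ ⟨⟨hle, heq⟩, hρ⟩
  have h0 : ρ.1 0 = π.1 0 := (hle 0 one_pos).resolve_left (hmin ρ hρ)
  exact Subtype.ext (funext fun j => heq 0 one_pos h0 j j.zero_le)

theorem exists_isolated_of_nonempty (Q : Quasimodel PV Γ) {A : Set (RPath Q)}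
    (hA : A.Nonempty) :
    ∃ x ∈ A, ∃ O : Set (RPath Q),
      @IsOpen (RPath Q) (limitTopology Q) O ∧ x ∈ O ∧ O ∩ A = {x} := by
  obtain ⟨_, ⟨π, hπ, rfl⟩, hmin⟩ :=
    Q.wellFounded_lt.has_min ((fun π : RPath Q => π.1 0) '' A) (hA.image _)
  exact ⟨π, hπ, Nbhd Q π 1, isOpen_nbhd Q π 1, mem_nbhd_self Q π 1,
    nbhd_one_inter_eq_singleton Q hπ fun ρ hρ => hmin _ (Set.mem_image_of_mem _ hρ)⟩

/-- the space of realising paths with the topology `T⃗_≺` is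
scattered: every nonempty set has an isolated point. -/
theorem limitTopology_scattered {PV : Type} {Γ : Finset (Formula PV)}
    (Q : Quasimodel PV Γ) :
    @Scattered (RPath Q) (limitTopology Q) ∧
    ∀ A : Set (RPath Q), A.Nonempty →
      ∃ x ∈ A, ∃ O : Set (RPath Q),
        @IsOpen (RPath Q) (limitTopology Q) O ∧ x ∈ O ∧ O ∩ A = {x} := by
  refine ⟨fun S hS => ?_, fun A hA => exists_isolated_of_nonempty Q hA⟩
  by_contra hne
  obtain ⟨x, hx, O, hO, hxO, hOS⟩ :=
    exists_isolated_of_nonempty Q (Set.nonempty_iff_ne_empty.2 hne)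
  obtain ⟨y, hy, hyx⟩ := hS hx O hO hxO
  rw [hOS] at hy
  exact hyx hy

end

end Untangled
end

section
/- Simulation formulas characterise simulation: let Σ ⋐ L and let w be a Σ-state. For every dynamic poset model M and every x ∈ |M|, x ∈ [[Sim(w)]]_M if and only if w ◁ (M, x), i.e. there is a labelled simulation χ ⊆ |w|×|M| (with respect to the associated Σ-labelling of M) such that 0_w χ x. -/
open scoped Classical

namespace Untangled

noncomputable section

variable {PV : Type} {Γ : Finset (Formula PV)}

/-- In the downset topology, the Cantor derivative of `A` consists of the points strictly above
some point of `A`. -/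
theorem mem_cantorDeriv_downsetTopology {X : Type*} {plt : X → X → Prop}
    (hirr : ∀ x, ¬ plt x x) (htr : ∀ a b c, plt a b → plt b c → plt a c) (A : Set X) (x : X) :
    x ∈ @cantorDeriv X (downsetTopology plt) A ↔ ∃ y, plt y x ∧ y ∈ A := by
  constructor
  · intro h
    obtain ⟨y, ⟨hy, hyA⟩, hne⟩ := h {y | plt y x ∨ y = x}
      (by
        rintro a (ha | rfl) b hb
        · exact Or.inl (htr _ _ _ hb ha)
        · exact Or.inl hb)
      (Or.inr rfl)
    exact ⟨y, hy.resolve_right hne, hyA⟩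
  · rintro ⟨y, hyx, hyA⟩ U hU hxU
    exact ⟨y, ⟨hU x hxU y hyx, hyA⟩, fun h => hirr x (h ▸ hyx)⟩

theorem mem_truthSet_bigAnd {PV : Type} [Inhabited PV] {X : Type*} [TopologicalSpace X]
    (f : X → X) (ν : PV → Set X) (l : List (Formula PV)) (x : X) :
    x ∈ truthSet f ν (bigAnd l) ↔ ∀ φ ∈ l, x ∈ truthSet f ν φ := by
  induction l with
  | nil => simp [bigAnd, fTop, truthSet]
  | cons φ l ih =>
    have h : bigAnd (φ :: l) = φ.and (bigAnd l) := rfl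
    simp [h, truthSet, ih]

theorem mem_truthSet_sneg {PV : Type} {X : Type*} [TopologicalSpace X]
    (f : X → X) (ν : PV → Set X) (φ : Formula PV) (x : X) :
    x ∈ truthSet f ν φ.sneg ↔ x ∉ truthSet f ν φ := by
  cases φ <;> simp [Formula.sneg, truthSet]

/-- A point satisfies all members of a type iff the type is exactly the set of formulas of `Γ`
true at the point. -/
theorem IsType.forall_mem_truthSet_iff {PV : Type} {Γ Φ : Finset (Formula PV)} (hΦ : IsType Γ Φ)
    {X : Type*} [TopologicalSpace X] (f : X → X) (ν : PV → Set X) (x : X) :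
    (∀ φ ∈ Φ, x ∈ truthSet f ν φ) ↔ ∀ φ ∈ Γ, (φ ∈ Φ ↔ x ∈ truthSet f ν φ) := by
  constructor
  · intro h φ hφ
    refine ⟨h φ, fun hx => (hΦ.total φ hφ).resolve_right fun hs => ?_⟩
    exact (mem_truthSet_sneg f ν φ x).1 (h _ hs) hx
  · intro h φ hφ
    exact (h φ (hΦ.subset hφ)).1 hφ

theorem mem_truthSet_Sim {PV : Type} [Inhabited PV] [DecidableEq PV] {Γ : Finset (Formula PV)}
    (w : SState PV Γ) {X : Type*} {plt : X → X → Prop}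
    (hirr : ∀ x, ¬ plt x x) (htr : ∀ a b c, plt a b → plt b c → plt a c)
    (f : X → X) (ν : PV → Set X) (x : X) :
    x ∈ @truthSet PV X (downsetTopology plt) f ν (Sim w) ↔
      (∀ φ ∈ Γ, (φ ∈ w.label w.root ↔ x ∈ @truthSet PV X (downsetTopology plt) f ν φ)) ∧
      ∀ a (ha : a ∈ w.carrier), a ≠ w.root →
        ∃ y, plt y x ∧ y ∈ @truthSet PV X (downsetTopology plt) f ν (Sim (w.substateAt a ha)) := by
  let _ := downsetTopology plt
  rw [Sim, truthSet, Set.mem_inter_iff, mem_truthSet_bigAnd, mem_truthSet_bigAnd,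
    ← (w.label_type w.root w.root_mem).forall_mem_truthSet_iff f ν x]
  refine and_congr (by simp) ⟨fun h a ha hne => ?_, fun h φ hφ => ?_⟩
  · exact (mem_cantorDeriv_downsetTopology hirr htr _ x).1 (h _ (List.mem_map.2
      ⟨⟨a, Finset.mem_erase.2 ⟨hne, ha⟩⟩, Finset.mem_toList.2 (Finset.mem_attach _ _), rfl⟩))
  · obtain ⟨⟨a, ha⟩, -, rfl⟩ := List.mem_map.1 hφ
    exact (mem_cantorDeriv_downsetTopology hirr htr _ x).2
      (h a (Finset.mem_of_mem_erase ha) (Finset.ne_of_mem_erase ha))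

namespace SState

theorem substateAt_root {PV : Type} {Γ : Finset (Formula PV)} (w : SState PV Γ) :
    w.substateAt w.root w.root_mem = w := by
  have h : w.carrier.filter (fun u => w.lt u w.root ∨ u = w.root) = w.carrier :=
    Finset.filter_true_of_mem fun a ha => (em (a = w.root)).elim Or.inr
      fun hne => Or.inl (w.root_top a ha hne)
  cases w
  simp only [substateAt, mk.injEq, and_true]
  exact h

theorem substateAt_substateAt {PV : Type} {Γ : Finset (Formula PV)} (w : SState PV Γ)
    {a b : ℕ} (ha : a ∈ w.carrier) (hb : b ∈ w.carrier)
    (hba : b ∈ (w.substateAt a ha).carrier) :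
    (w.substateAt a ha).substateAt b hba = w.substateAt b hb := by
  have hle : w.lt b a ∨ b = a := (Finset.mem_filter.1 hba).2
  simp only [substateAt, mk.injEq, and_true]
  ext u
  refine ⟨fun h => ?_, fun h => ?_⟩
  · obtain ⟨h₁, h₂⟩ := Finset.mem_filter.1 h
    exact Finset.mem_filter.2 ⟨(Finset.mem_filter.1 h₁).1, h₂⟩
  obtain ⟨h₁, h₂⟩ := Finset.mem_filter.1 h
  refine Finset.mem_filter.2 ⟨Finset.mem_filter.2 ⟨h₁, ?_⟩, h₂⟩
  rcases h₂ with hu | rfl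
  · rcases hle with hl | rfl
    · exact Or.inl (w.lt_trans _ _ _ hu hl)
    · exact Or.inl hu
  · exact hle

end SState

/-- A labelled simulation from `w` relates the root only to points satisfying `Sim w`. -/
theorem mem_truthSet_Sim_of_simulation {PV : Type} [Inhabited PV] [DecidableEq PV]
    {Γ : Finset (Formula PV)} (w : SState PV Γ) {X : Type*} {plt : X → X → Prop}
    (hirr : ∀ x, ¬ plt x x) (htr : ∀ a b c, plt a b → plt b c → plt a c)
    (f : X → X) (ν : PV → Set X) (χ : ℕ → X → Prop)
    (hlab : ∀ a y, χ a y → ∀ φ ∈ Γ,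
      (φ ∈ w.label a ↔ y ∈ @truthSet PV X (downsetTopology plt) f ν φ))
    (hconf : ∀ a' a y, χ a y → w.lt a' a → a' ∈ w.carrier → ∃ y', plt y' y ∧ χ a' y')
    (x : X) (hx : χ w.root x) :
    x ∈ @truthSet PV X (downsetTopology plt) f ν (Sim w) := by
  induction hn : w.carrier.card using Nat.strong_induction_on generalizing w x with
  | _ n ih =>
    refine (mem_truthSet_Sim w hirr htr f ν x).2 ⟨hlab _ _ hx, fun a ha hne => ?_⟩
    obtain ⟨y, hyx, hay⟩ := hconf a w.root x hx (w.root_top a ha hne) ha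
    exact ⟨y, hyx, ih _ (hn ▸ w.substateAt_card_lt a (Finset.mem_erase.2 ⟨hne, ha⟩))
      (w.substateAt a ha) hlab
      (fun a' b y h hlt ha' => hconf a' b y h hlt (Finset.mem_filter.1 ha').1) y hay rfl⟩

/-- simulation formulas characterise simulation on dynamic
poset models: `x ∈ [[Sim(w)]]` iff `w` simulates `(M, x)` (with respect to
the associated `Σ`-labelling of `M`). -/
theorem sim_formula_characterises {PV : Type} [Inhabited PV] [DecidableEq PV]
    {Γ : Finset (Formula PV)} (hΓ : GoodSigma Γ) (w : SState PV Γ)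
    (X : Type) (plt : X → X → Prop)
    (hirr : ∀ x, ¬ plt x x) (htr : ∀ a b c, plt a b → plt b c → plt a c)
    (hlf : ∀ x, Set.Finite {y | plt y x})
    (f : X → X)
    (hf : @Continuous X X (downsetTopology plt) (downsetTopology plt) f)
    (ν : PV → Set X) (x : X) :
    x ∈ @truthSet PV X (downsetTopology plt) f ν (Sim w) ↔
      ∃ χ : ℕ → X → Prop,
        (∀ a y, χ a y → a ∈ w.carrier) ∧
        (∀ a y, χ a y → ∀ φ ∈ Γ,
          (φ ∈ w.label a ↔ y ∈ @truthSet PV X (downsetTopology plt) f ν φ)) ∧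
        (∀ a' a y, χ a y → w.lt a' a → a' ∈ w.carrier →
          ∃ y', plt y' y ∧ χ a' y') ∧
        χ w.root x := by
  constructor
  · intro hx
    refine ⟨fun a y => ∃ ha : a ∈ w.carrier,
      y ∈ @truthSet PV X (downsetTopology plt) f ν (Sim (w.substateAt a ha)),
      fun a y h => h.1, ?_, ?_, w.root_mem, by rwa [w.substateAt_root]⟩
    · rintro a y ⟨ha, hy⟩
      exact ((mem_truthSet_Sim _ hirr htr f ν y).1 hy).1
    · rintro b a y ⟨ha, hy⟩ hlt hb
      have hba : b ∈ (w.substateAt a ha).carrier := Finset.mem_filter.2 ⟨hb, Or.inl hlt⟩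
      obtain ⟨z, hzy, hz⟩ := ((mem_truthSet_Sim _ hirr htr f ν y).1 hy).2 b hba
        fun h : b = a => w.lt_irrefl a (h ▸ hlt)
      rw [w.substateAt_substateAt ha hb hba] at hz
      exact ⟨z, hzy, hb, hz⟩
  · rintro ⟨χ, -, hlab, hconf, hx⟩
    exact mem_truthSet_Sim_of_simulation w hirr htr f ν χ hlab hconf x hx

end

end Untangled
end

section
/- Well-quasi-ordering of Σ-states under simulation: let Σ ⋐ L. For every infinite sequence w_0, w_1, w_2, … of Σ-states there exist indices i < j < ω such that w_i ◁ w_j (w_i simulates w_j). -/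
open scoped Classical

namespace Untangled

noncomputable section

variable {PV : Type} {Γ : Finset (Formula PV)}

/-- If labels lie in a finite set and lists of children in a partially well-ordered set, then every
sequence has two terms with equal labels whose lists of children embed. -/
theorem exists_lt_label_eq_sublistForall₂ {α β : Type*} {r : α → α → Prop} [IsPreorder α r]
    {s : Set α} (hs : s.PartiallyWellOrderedOn r) {t : Set β} (ht : t.Finite)
    (lab : α → β) (children : α → List α) (f : ℕ → α)
    (hlab : ∀ n, lab (f n) ∈ t) (hf : ∀ n, ∀ c ∈ children (f n), c ∈ s) :
    ∃ i j, i < j ∧ lab (f i) = lab (f j) ∧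
      List.SublistForall₂ r (children (f i)) (children (f j)) := by
  have hprod := (ht.partiallyWellOrderedOn (r := Eq)).prod
    (Set.PartiallyWellOrderedOn.partiallyWellOrderedOn_sublistForall₂ r hs)
  obtain ⟨i, j, hij, h⟩ := hprod.exists_lt
    (f := fun n => (lab (f n), children (f n))) fun n => ⟨hlab n, hf n⟩
  exact ⟨i, j, hij, h⟩

/-- A version of **Kruskal's tree theorem** for a preorder generated by finite labels and lists of
children of smaller rank. -/
theorem wellQuasiOrdered_of_children {α β : Type*} {r : α → α → Prop} [IsPreorder α r]
    (rk : α → ℕ) {t : Set β} (ht : t.Finite) (lab : α → β) (hlab : ∀ a, lab a ∈ t)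
    (children : α → List α) (rk_lt : ∀ a, ∀ c ∈ children a, rk c < rk a)
    (rel_of_child : ∀ a b c, c ∈ children b → r a c → r a b)
    (rel_of_children : ∀ a b, lab a = lab b →
      List.SublistForall₂ r (children a) (children b) → r a b) :
    (Set.univ : Set α).PartiallyWellOrderedOn r := by
  rw [Set.PartiallyWellOrderedOn.iff_not_exists_isMinBadSeq rk]
  rintro ⟨f, hf, hmin⟩
  have hs : {c | ∃ n, c ∈ children (f n)}.PartiallyWellOrderedOn r := by
    rw [Set.PartiallyWellOrderedOn.iff_forall_not_isBadSeq]
    rintro g ⟨hg, hbad⟩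
    choose k hk using hg
    obtain ⟨p, hp⟩ : ∃ p, ∀ m, k p ≤ k m := by
      obtain ⟨p, hp⟩ := WellFounded.has_min (measure k).wf Set.univ Set.univ_nonempty
      exact ⟨p, fun m => not_lt.mp (hp.2 m trivial)⟩
    refine hmin (k p) (fun n => if n < k p then f n else g (p + (n - k p)))
      (fun m hm => (if_pos hm).symm) ?_ ⟨fun _ => trivial, fun m n hmn h => ?_⟩
    · simpa using rk_lt _ _ (hk p)
    · beta_reduce at h
      by_cases hn : n < k p
      · rw [if_pos hn, if_pos (hmn.trans hn)] at h
        exact hf.2 m n hmn h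
      · rw [if_neg hn] at h
        by_cases hm : m < k p
        · rw [if_pos hm] at h
          exact hf.2 m _ (hm.trans_le (hp _)) (rel_of_child _ _ _ (hk _) h)
        · rw [if_neg hm] at h
          exact hbad _ _ (by omega) h
  obtain ⟨i, j, hij, hl, hc⟩ := exists_lt_label_eq_sublistForall₂ hs ht lab children f
    (fun n => hlab _) fun n c hc => ⟨n, hc⟩
  exact hf.2 i j hij (rel_of_children _ _ hl hc)

theorem _root_.List.SublistForall₂.exists_mem {α β : Type*} {r : α → β → Prop} {l : List α}
    {m : List β} (h : List.SublistForall₂ r l m) : ∀ a ∈ l, ∃ b ∈ m, r a b := by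
  induction h <;> simp_all

/-- A point of a `Σ`-state. -/
structure SPoint (PV : Type) (Γ : Finset (Formula PV)) where
  state : SState PV Γ
  point : ℕ
  mem : point ∈ state.carrier

namespace SPoint

variable {PV : Type} {Γ : Finset (Formula PV)}

/-- The root of a state, as a point of it. -/
def ofRoot (w : SState PV Γ) : SPoint PV Γ := ⟨w, w.root, w.root_mem⟩

/-- The label of a point. -/
def label (p : SPoint PV Γ) : Finset (Formula PV) := p.state.label p.point

/-- The strict order on the points of a common state. -/
def Below (q p : SPoint PV Γ) : Prop := q.state = p.state ∧ p.state.lt q.point p.point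

/-- Some labelled simulation relates the points `p` and `q`. -/
def Sim (p q : SPoint PV Γ) : Prop :=
  ∃ χ : SPoint PV Γ → SPoint PV Γ → Prop,
    (∀ a b, χ a b → a.label = b.label) ∧
    (∀ a' a b, χ a b → Below a' a → ∃ b', Below b' b ∧ χ a' b') ∧ χ p q

/-- Some labelled simulation relates the point `p` to `q` or to a point below `q`. -/
def Emb (p q : SPoint PV Γ) : Prop := ∃ q', (q' = q ∨ Below q' q) ∧ Sim p q'

theorem Below.trans {p q u : SPoint PV Γ} (h₁ : Below p q) (h₂ : Below q u) : Below p u :=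
  ⟨h₁.1.trans h₂.1, u.state.lt_trans _ _ _ (h₂.1 ▸ h₁.2) h₂.2⟩

theorem Below.irrefl (p : SPoint PV Γ) : ¬ Below p p := fun h => p.state.lt_irrefl _ h.2

theorem Sim.label_eq {p q : SPoint PV Γ} : Sim p q → p.label = q.label :=
  fun ⟨_, hl, _, h⟩ => hl _ _ h

theorem Sim.exists_below {p' p q : SPoint PV Γ} :
    Sim p q → Below p' p → ∃ q', Below q' q ∧ Sim p' q' := by
  rintro ⟨χ, hl, hc, h⟩ hp
  obtain ⟨q', hq, h'⟩ := hc _ _ _ h hp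
  exact ⟨q', hq, χ, hl, hc, h'⟩

theorem Sim.refl (p : SPoint PV Γ) : Sim p p :=
  ⟨Eq, fun _ _ h => congrArg label h, fun a' _ _ h ha => ⟨a', h ▸ ha, rfl⟩, rfl⟩

theorem Sim.trans {p q u : SPoint PV Γ} (h₁ : Sim p q) (h₂ : Sim q u) : Sim p u := by
  refine ⟨fun a c => ∃ b, Sim a b ∧ Sim b c, ?_, ?_, q, h₁, h₂⟩
  · rintro a c ⟨b, hab, hbc⟩
    exact hab.label_eq.trans hbc.label_eq
  · rintro a' a c ⟨b, hab, hbc⟩ ha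
    obtain ⟨b', hb, hab'⟩ := hab.exists_below ha
    obtain ⟨c', hc, hbc'⟩ := hbc.exists_below hb
    exact ⟨c', hc, b', hab', hbc'⟩

theorem Sim.of_below {p q : SPoint PV Γ} (hl : p.label = q.label)
    (h : ∀ p', Below p' p → ∃ q', Below q' q ∧ Sim p' q') : Sim p q := by
  refine ⟨fun a b => (a = p ∧ b = q) ∨ Sim a b, ?_, ?_, Or.inl ⟨rfl, rfl⟩⟩
  · rintro a b (⟨rfl, rfl⟩ | hab)
    exacts [hl, hab.label_eq]
  · rintro a' a b (⟨rfl, rfl⟩ | hab) ha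
    · obtain ⟨b', hb, hs⟩ := h _ ha
      exact ⟨b', hb, Or.inr hs⟩
    · obtain ⟨b', hb, hs⟩ := hab.exists_below ha
      exact ⟨b', hb, Or.inr hs⟩

theorem Sim.emb {p q : SPoint PV Γ} (h : Sim p q) : Emb p q := ⟨q, Or.inl rfl, h⟩

theorem Emb.of_below {p q u : SPoint PV Γ} (h : Emb p q) (hq : Below q u) : Emb p u := by
  obtain ⟨q', rfl | hq', hs⟩ := h
  exacts [⟨_, Or.inr hq, hs⟩, ⟨_, Or.inr (hq'.trans hq), hs⟩]

instance : IsPreorder (SPoint PV Γ) Emb where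
  refl p := (Sim.refl p).emb
  trans p q u := by
    rintro ⟨q', rfl | hq, hs⟩ ⟨u', hu, hs'⟩
    · exact ⟨u', hu, hs.trans hs'⟩
    · obtain ⟨v, hv, hs''⟩ := hs'.exists_below hq
      have : Emb p v := (hs.trans hs'').emb
      obtain rfl | hu := hu
      exacts [this.of_below hv, this.of_below (hv.trans hu)]

theorem finite_below (p : SPoint PV Γ) : {q | Below q p}.Finite := by
  refine Set.Finite.of_finite_image (f := point)
    (p.state.carrier.finite_toSet.subset ?_) ?_
  · rintro _ ⟨q, hq, rfl⟩
    exact hq.1 ▸ q.mem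
  · rintro ⟨v, a, ha⟩ ⟨rfl, -⟩ ⟨u, b, hb⟩ ⟨rfl, -⟩ h
    cases h
    rfl

/-- The list of the points strictly below a given one. -/
def belowList (p : SPoint PV Γ) : List (SPoint PV Γ) := p.finite_below.toFinset.toList

@[simp]
theorem mem_belowList {p q : SPoint PV Γ} : q ∈ p.belowList ↔ Below q p := by
  simp [belowList]

theorem Sim.of_sublistForall₂ {p q : SPoint PV Γ} (hl : p.label = q.label)
    (h : List.SublistForall₂ Emb p.belowList q.belowList) : Sim p q := by
  refine Sim.of_below hl fun p' hp => ?_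
  obtain ⟨u, hu, q', hq, hs⟩ := h.exists_mem p' (mem_belowList.mpr hp)
  rw [mem_belowList] at hu
  obtain rfl | hq := hq
  exacts [⟨_, hu, hs⟩, ⟨_, hq.trans hu, hs⟩]

theorem label_mem_powerset (p : SPoint PV Γ) : p.label ∈ (Γ.powerset : Set (Finset (Formula PV))) :=
  Finset.mem_coe.mpr (Finset.mem_powerset.mpr (p.state.label_type _ p.mem).subset)

theorem partiallyWellOrderedOn_emb :
    (Set.univ : Set (SPoint PV Γ)).PartiallyWellOrderedOn Emb := by
  refine wellQuasiOrdered_of_children (fun p => p.finite_below.toFinset.card)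
    Γ.powerset.finite_toSet label label_mem_powerset belowList ?_ ?_ ?_
  · intro p q hq
    rw [mem_belowList] at hq
    refine Finset.card_lt_card (Finset.ssubset_iff_subset_ne.mpr ⟨fun u hu => ?_, fun h => ?_⟩)
    · simp only [Set.Finite.mem_toFinset, Set.mem_ofPred_eq] at hu ⊢
      exact hu.trans hq
    · have : q ∈ p.finite_below.toFinset := by simpa using hq
      rw [← h] at this
      exact Below.irrefl q (by simpa using this)
  · exact fun p q u hu h => h.of_below (mem_belowList.mp hu)
  · exact fun p q hl h => (Sim.of_sublistForall₂ hl h).emb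

theorem Sim.simulates {w v : SState PV Γ} (h : Sim (ofRoot w) (ofRoot v)) : Simulates w v := by
  refine ⟨fun a b => ∃ (ha : a ∈ w.carrier) (hb : b ∈ v.carrier), Sim ⟨w, a, ha⟩ ⟨v, b, hb⟩,
    ?_, ?_, ?_, w.root_mem, v.root_mem, h⟩
  · rintro a b ⟨ha, hb, -⟩
    exact ⟨ha, hb⟩
  · rintro a b ⟨ha, hb, hs⟩
    exact hs.label_eq
  · rintro a' a b ⟨ha, hb, hs⟩ hlt ha'
    obtain ⟨⟨u, b', hb'⟩, ⟨hu, hlt'⟩, hs'⟩ := hs.exists_below (p' := ⟨w, a', ha'⟩) ⟨rfl, hlt⟩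
    cases hu
    exact ⟨b', hb', hlt', ha', hb', hs'⟩

end SPoint

/-- well-quasi-ordering of `Σ`-states under simulation: in any
infinite sequence of `Σ`-states some earlier state simulates a later one. -/
theorem states_wqo {PV : Type} {Γ : Finset (Formula PV)} (hΓ : GoodSigma Γ)
    (w : ℕ → SState PV Γ) :
    ∃ i j : ℕ, i < j ∧ Simulates (w i) (w j) := by
  obtain ⟨i, j, hij, hl, hc⟩ := exists_lt_label_eq_sublistForall₂
    SPoint.partiallyWellOrderedOn_emb Γ.powerset.finite_toSet SPoint.label SPoint.belowList
    (fun n => SPoint.ofRoot (w n)) (fun n => SPoint.label_mem_powerset _) fun _ _ _ => trivial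
  exact ⟨i, j, hij, (SPoint.Sim.of_sublistForall₂ hl hc).simulates⟩

end

end Untangled
end
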